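/- In every multi-graph allocation instance on n agents with a finite item set M in which every agent i has a normalized, monotone, subadditive valuation v_i on M satisfying v_i(S) = v_i(S ∩ M^i) for all S ⊆ M, and every agent i has an entitlement b_i > 0 with b_1 + ⋯ + b_n = 1, there exists an orientation allocation in which every agent i receives a bundle A_i with v_i(A_i) ≥ (1/2)·APS(M, v_i, b_i). -/

import Mathlib

open Finset

/-- A valuation on `M`: normalized, monotone, and subadditive. -/
def IsValuation {α : Type*} [DecidableEq α] (M : Finset α) (v : Finset α → ℝ) : Prop :=
  v ∅ = 0 ∧ (∀ S T : Finset α, S ⊆ T → T ⊆ M → v S ≤ v T) ∧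
    ∀ S T : Finset α, S ⊆ M → T ⊆ M → v (S ∪ T) ≤ v S + v T

/-- The anyprice share `APS(M, v, b)`: the supremum, over all fractional `b`-partitions
`(P_1, …, P_k; λ_1, …, λ_k)` of `M`, of `min_{j : λ_j > 0} v (P j)`. -/
noncomputable def APS {α : Type*} [DecidableEq α] (M : Finset α) (v : Finset α → ℝ)
    (b : ℝ) : ℝ :=
  sSup {x : ℝ | ∃ (k : ℕ) (P : Fin k → Finset α) (lam : Fin k → ℝ),
    (∀ j, P j ⊆ M) ∧ (∀ j, 0 ≤ lam j) ∧ (∑ j, lam j = 1) ∧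
    (∀ e ∈ M, ∑ j ∈ Finset.univ.filter (fun j => e ∈ P j), lam j = b) ∧
    x = sInf {y : ℝ | ∃ j, 0 < lam j ∧ y = v (P j)}}

theorem prod_rpow_add_prod_rpow_le {ι : Type*} (s : Finset ι) (w a c : ι → ℝ)
    (hw : ∀ j ∈ s, 0 ≤ w j) (hw1 : ∑ j ∈ s, w j = 1)
    (ha : ∀ j ∈ s, 0 ≤ a j) (hc : ∀ j ∈ s, 0 ≤ c j) :
    ∏ j ∈ s, a j ^ w j + ∏ j ∈ s, c j ^ w j ≤ ∏ j ∈ s, (a j + c j) ^ w j := by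
  by_cases h : ∃ j ∈ s, a j + c j = 0 ∧ w j ≠ 0
  · obtain ⟨j, hj, h0, hwj⟩ := h
    have haj : a j = 0 := by linarith [ha j hj, hc j hj]
    have hcj : c j = 0 := by linarith [ha j hj, hc j hj]
    rw [Finset.prod_eq_zero hj (by rw [haj, Real.zero_rpow hwj]),
      Finset.prod_eq_zero hj (by rw [hcj, Real.zero_rpow hwj]), add_zero]
    exact Finset.prod_nonneg fun k hk => Real.rpow_nonneg (add_nonneg (ha k hk) (hc k hk)) _
  · push Not at h
    have hsum : ∀ j ∈ s, 0 ≤ a j + c j := fun j hj => add_nonneg (ha j hj) (hc j hj)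
    have h4 : 0 ≤ ∏ j ∈ s, (a j + c j) ^ w j :=
      Finset.prod_nonneg fun k hk => Real.rpow_nonneg (hsum k hk) _
    have factor : ∀ d : ι → ℝ, (∀ j ∈ s, 0 ≤ d j) → ∏ j ∈ s, d j ^ w j ≤
        (∑ j ∈ s, w j * (d j / (a j + c j))) * ∏ j ∈ s, (a j + c j) ^ w j := by
      intro d hd
      have hdiv : ∀ j ∈ s, 0 ≤ d j / (a j + c j) := fun j hj => div_nonneg (hd j hj) (hsum j hj)
      have hsplit : ∏ j ∈ s, d j ^ w j =
          (∏ j ∈ s, (d j / (a j + c j)) ^ w j) * ∏ j ∈ s, (a j + c j) ^ w j := by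
        rw [← Finset.prod_mul_distrib]
        refine Finset.prod_congr rfl fun j hj => ?_
        by_cases h0 : a j + c j = 0
        · simp [h j hj h0]
        · rw [← Real.mul_rpow (hdiv j hj) (hsum j hj), div_mul_cancel₀ _ h0]
      rw [hsplit]
      exact mul_le_mul_of_nonneg_right
        (Real.geom_mean_le_arith_mean_weighted s w _ hw hw1 hdiv) h4
    have h3 : ∑ j ∈ s, w j * (a j / (a j + c j)) + ∑ j ∈ s, w j * (c j / (a j + c j)) ≤ 1 := by
      rw [← Finset.sum_add_distrib, ← hw1]
      refine Finset.sum_le_sum fun j hj => ?_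
      rw [← mul_add, ← add_div]
      exact mul_le_of_le_one_right (hw j hj) (div_self_le_one _)
    calc _ ≤ _ := add_le_add (factor a ha) (factor c hc)
      _ = (∑ j ∈ s, w j * (a j / (a j + c j)) + ∑ j ∈ s, w j * (c j / (a j + c j))) *
          ∏ j ∈ s, (a j + c j) ^ w j := by ring
      _ ≤ _ := mul_le_of_le_one_left h4 h3

/-- Finner's inequality on a finite Boolean cube, the functional form of Shearer's lemma. -/
theorem sum_powerset_prod_rpow_le {α ι : Type*} [DecidableEq α] [Fintype ι]
    (P : ι → Finset α) (w : ι → ℝ) (hw : ∀ j, 0 ≤ w j) (M : Finset α)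
    (hM : ∀ e ∈ M, ∑ j with e ∈ P j, w j = 1)
    (g : ι → Finset α → ℝ) (hg : ∀ j T, 0 ≤ g j T) :
    ∑ S ∈ M.powerset, ∏ j, g j (S ∩ P j) ^ w j ≤
      ∏ j, (∑ T ∈ (M ∩ P j).powerset, g j T) ^ w j := by
  induction M using Finset.induction_on generalizing g with
  | empty => simp
  | insert e M he ih =>
    have hM' : ∀ x ∈ M, ∑ j with x ∈ P j, w j = 1 := fun x hx => hM x (mem_insert_of_mem hx)
    set g' : ι → Finset α → ℝ := fun j T => if e ∈ P j then g j (insert e T) else g j T with hg'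
    have hg'0 : ∀ j T, 0 ≤ g' j T := by
      intro j T; simp only [hg']; split_ifs <;> exact hg _ _
    have ih0 := ih hM' g hg
    have ih1 := ih hM' g' hg'0
    set G : ι → ℝ := fun j => ∑ T ∈ (M ∩ P j).powerset, g j T with hG
    set G' : ι → ℝ := fun j => ∑ T ∈ (M ∩ P j).powerset, g' j T with hG'
    have hG0 : ∀ j, 0 ≤ G j := fun j => Finset.sum_nonneg fun T _ => hg j T
    have hG'0 : ∀ j, 0 ≤ G' j := fun j => Finset.sum_nonneg fun T _ => hg'0 j T
    have hstep : ∀ S, ∏ j, g j (insert e S ∩ P j) ^ w j = ∏ j, g' j (S ∩ P j) ^ w j := by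
      intro S
      refine Finset.prod_congr rfl fun j _ => ?_
      by_cases hj : e ∈ P j
      · simp [hg', hj, insert_inter_of_mem hj]
      · simp [hg', hj, insert_inter_of_notMem hj]
    have hright : ∀ j, ∑ T ∈ (insert e M ∩ P j).powerset, g j T =
        if e ∈ P j then G j + G' j else G j := by
      intro j
      by_cases hj : e ∈ P j
      · rw [insert_inter_of_mem hj, Finset.sum_powerset_insert (by simp [he])]
        simp [hG, hG', hg', hj]
      · rw [insert_inter_of_notMem hj]
        simp [hG, hj]
    have hGG' : ∀ j, e ∉ P j → G' j = G j := by
      intro j hj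
      simp [hG, hG', hg', hj]
    rw [Finset.sum_powerset_insert he]
    simp_rw [hstep, hright]
    have hsplit : ∀ d : ι → ℝ, ∏ j, d j ^ w j =
        (∏ j with e ∈ P j, d j ^ w j) * ∏ j with e ∉ P j, d j ^ w j :=
      fun d => (Finset.prod_filter_mul_prod_filter_not _ _ _).symm
    have hrest : ∏ j with e ∉ P j, G' j ^ w j = ∏ j with e ∉ P j, G j ^ w j :=
      Finset.prod_congr rfl fun j hj => by rw [hGG' j (by simpa using hj)]
    have htop : ∏ j with e ∈ P j, (if e ∈ P j then G j + G' j else G j) ^ w j =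
        ∏ j with e ∈ P j, (G j + G' j) ^ w j :=
      Finset.prod_congr rfl fun j hj => by rw [if_pos (by simpa using hj)]
    have hbot : ∏ j with e ∉ P j, (if e ∈ P j then G j + G' j else G j) ^ w j =
        ∏ j with e ∉ P j, G j ^ w j :=
      Finset.prod_congr rfl fun j hj => by rw [if_neg (by simpa using hj)]
    refine (add_le_add ih0 ih1).trans ?_
    rw [hsplit G, hsplit G', hrest, hsplit, htop, hbot, ← add_mul]
    exact mul_le_mul_of_nonneg_right
      (prod_rpow_add_prod_rpow_le _ w G G' (fun j _ => hw j) (hM e (mem_insert_self e M))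
        (fun j _ => hG0 j) (fun j _ => hG'0 j))
      (Finset.prod_nonneg fun j _ => Real.rpow_nonneg (hG0 j) _)

theorem IsValuation.nonneg {α : Type*} [DecidableEq α] {M : Finset α} {v : Finset α → ℝ}
    (hv : IsValuation M v) {S : Finset α} (hS : S ⊆ M) : 0 ≤ v S :=
  hv.1 ▸ hv.2.1 ∅ S (empty_subset S) hS

theorem IsValuation.two_mul_card_filter_lt_le {α : Type*} [DecidableEq α] {M : Finset α}
    {v : Finset α → ℝ} (hv : IsValuation M v) {P : Finset α} (hP : P ⊆ M) {x : ℝ}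
    (hx : x ≤ v P) :
    2 * (#{T ∈ P.powerset | v T < 1 / 2 * x} : ℝ) ≤ 2 ^ #P := by
  have hle : #{T ∈ P.powerset | v T < 1 / 2 * x} ≤ #{T ∈ P.powerset | ¬ v T < 1 / 2 * x} := by
    refine Finset.card_le_card_of_injOn (P \ ·) ?_ ?_
    · intro T hT
      simp only [coe_filter, mem_powerset, Set.mem_ofPred_eq] at hT ⊢
      refine ⟨sdiff_subset, fun hlt => ?_⟩
      have := hv.2.2 T (P \ T) (hT.1.trans hP) (sdiff_subset.trans hP)
      rw [union_sdiff_of_subset hT.1] at this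
      linarith [hT.2]
    · intro T hT T' hT' h
      simp only [coe_filter, mem_powerset, Set.mem_ofPred_eq] at hT hT' h
      rw [← Finset.sdiff_sdiff_eq_self hT.1, h, Finset.sdiff_sdiff_eq_self hT'.1]
  have hadd := Finset.card_filter_add_card_filter_not (s := P.powerset) (fun T => v T < 1 / 2 * x)
  rw [card_powerset] at hadd
  have : 2 * #{T ∈ P.powerset | v T < 1 / 2 * x} ≤ 2 ^ #P := by omega
  exact_mod_cast this

theorem IsValuation.card_filter_lt_le {α ι : Type*} [DecidableEq α] [Fintype ι] {M : Finset α}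
    {v : Finset α → ℝ} (hv : IsValuation M v) {b : ℝ} (hb : 0 < b) (P : ι → Finset α)
    (lam : ι → ℝ) (hP : ∀ j, P j ⊆ M) (hlam : ∀ j, 0 ≤ lam j) (hlam1 : ∑ j, lam j = 1)
    (hcov : ∀ e ∈ M, ∑ j with e ∈ P j, lam j = b) {x : ℝ}
    (hx : ∀ j, 0 < lam j → x ≤ v (P j)) :
    (#{S ∈ M.powerset | v S < 1 / 2 * x} : ℝ) ≤ (2 : ℝ) ^ ((#M : ℝ) - 1 / b) := by
  classical
  set w : ι → ℝ := fun j => lam j / b with hwdef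
  have hw : ∀ j, 0 ≤ w j := fun j => div_nonneg (hlam j) hb.le
  have hwcov : ∀ e ∈ M, ∑ j with e ∈ P j, w j = 1 := by
    intro e he
    rw [← Finset.sum_div, hcov e he, div_self hb.ne']
  set g : ι → Finset α → ℝ := fun _ T => if v T < 1 / 2 * x then 1 else 0 with hgdef
  have hg : ∀ j T, 0 ≤ g j T := by
    intro j T; simp only [hgdef]; split_ifs <;> norm_num
  have key := sum_powerset_prod_rpow_le P w hw M hwcov g hg
  have hlhs : (#{S ∈ M.powerset | v S < 1 / 2 * x} : ℝ) ≤
      ∑ S ∈ M.powerset, ∏ j, g j (S ∩ P j) ^ w j := by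
    rw [Finset.card_filter, Nat.cast_sum]
    refine Finset.sum_le_sum fun S hS => ?_
    split_ifs with h
    · have hone : ∀ j, g j (S ∩ P j) = 1 := fun j => by
        simp only [hgdef]
        rw [if_pos]
        exact (hv.2.1 _ S inter_subset_left (mem_powerset.1 hS)).trans_lt h
      simp [hone]
    · rw [Nat.cast_zero]
      exact Finset.prod_nonneg fun j _ => Real.rpow_nonneg (hg j _) _
  have hfac : ∀ j, (∑ T ∈ (M ∩ P j).powerset, g j T) ^ w j ≤
      (2 : ℝ) ^ (((#(P j) : ℝ) - 1) * w j) := by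
    intro j
    rcases (hlam j).eq_or_lt with h0 | hpos
    · simp [hwdef, ← h0]
    · have h2 := hv.two_mul_card_filter_lt_le (hP j) (hx j hpos)
      rw [inter_eq_right.2 (hP j), Real.rpow_mul (by norm_num)]
      refine Real.rpow_le_rpow (Finset.sum_nonneg fun T _ => hg j T) ?_ (hw j)
      rw [Real.rpow_sub (by norm_num), Real.rpow_natCast, Real.rpow_one]
      simp only [hgdef, Finset.sum_boole]
      linarith
  have hexp : ∑ j, ((#(P j) : ℝ) - 1) * w j = (#M : ℝ) - 1 / b := by
    have h1 : ∑ j, (#(P j) : ℝ) * w j = #M := by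
      have h : ∀ j, (#(P j) : ℝ) * w j = ∑ e ∈ M, if e ∈ P j then w j else 0 := by
        intro j
        rw [← Finset.sum_filter, Finset.filter_mem_eq_inter, inter_eq_right.2 (hP j)]
        simp
      simp_rw [h]
      rw [Finset.sum_comm]
      simp_rw [← Finset.sum_filter]
      rw [Finset.sum_congr rfl hwcov]
      simp
    have h2 : ∑ j, w j = 1 / b := by rw [← Finset.sum_div, hlam1]
    simp_rw [sub_mul, one_mul]
    rw [Finset.sum_sub_distrib, h1, h2]
  calc _ ≤ _ := hlhs
    _ ≤ _ := key
    _ ≤ ∏ j, (2 : ℝ) ^ (((#(P j) : ℝ) - 1) * w j) :=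
      Finset.prod_le_prod
        (fun j _ => Real.rpow_nonneg (Finset.sum_nonneg fun T _ => hg j T) _) fun j _ => hfac j
    _ = _ := by rw [← Real.rpow_sum_of_pos (by norm_num), hexp]

theorem IsValuation.aps_eq_zero_or_exists_partition {α : Type*} [DecidableEq α] {M : Finset α}
    {v : Finset α → ℝ} (hv : IsValuation M v) (b : ℝ) :
    APS M v b = 0 ∨ ∃ (k : ℕ) (P : Fin k → Finset α) (lam : Fin k → ℝ),
      (∀ j, P j ⊆ M) ∧ (∀ j, 0 ≤ lam j) ∧ (∑ j, lam j = 1) ∧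
      (∀ e ∈ M, ∑ j with e ∈ P j, lam j = b) ∧ ∀ j, 0 < lam j → APS M v b ≤ v (P j) := by
  unfold APS
  set A : Set ℝ := {x : ℝ | ∃ (k : ℕ) (P : Fin k → Finset α) (lam : Fin k → ℝ),
    (∀ j, P j ⊆ M) ∧ (∀ j, 0 ≤ lam j) ∧ (∑ j, lam j = 1) ∧
    (∀ e ∈ M, ∑ j ∈ Finset.univ.filter (fun j => e ∈ P j), lam j = b) ∧
    x = sInf {y : ℝ | ∃ j, 0 < lam j ∧ y = v (P j)}} with hA
  rcases A.eq_empty_or_nonempty with hempty | hne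
  · left; rw [hempty, Real.sSup_empty]
  · right
    have hsub : A ⊆ v '' (M.powerset : Set (Finset α)) := by
      rintro x ⟨k, P, lam, hP, hlam, hlam1, -, rfl⟩
      have hfin : {y : ℝ | ∃ j, 0 < lam j ∧ y = v (P j)}.Finite :=
        (Set.finite_range fun j => v (P j)).subset (by rintro y ⟨j, -, rfl⟩; exact ⟨j, rfl⟩)
      have hnon : {y : ℝ | ∃ j, 0 < lam j ∧ y = v (P j)}.Nonempty := by
        obtain ⟨j, -, hj⟩ := Finset.exists_lt_of_sum_lt (s := Finset.univ) (f := fun _ => (0 : ℝ))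
          (g := lam) (by simp [hlam1])
        exact ⟨_, j, hj, rfl⟩
      obtain ⟨j, -, hj⟩ := hnon.csInf_mem hfin
      exact ⟨P j, by simpa using hP j, hj.symm⟩
    obtain ⟨k, P, lam, hP, hlam, hlam1, hcov, hval⟩ :=
      hne.csSup_mem ((M.powerset.finite_toSet.image v).subset hsub)
    refine ⟨k, P, lam, hP, hlam, hlam1, hcov, fun j hj => ?_⟩
    rw [hval]
    refine csInf_le ⟨0, ?_⟩ ⟨j, hj, rfl⟩
    rintro y ⟨l, -, rfl⟩
    exact hv.nonneg (hP l)

theorem IsValuation.card_filter_lt_aps_lt {α : Type*} [DecidableEq α] {M : Finset α}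
    {v : Finset α → ℝ} (hv : IsValuation M v) {b : ℝ} (hb : 0 < b) (hb1 : b ≤ 1) :
    (#{S ∈ M.powerset | v S < 1 / 2 * APS M v b} : ℝ) < b * 2 ^ #M := by
  rcases hv.aps_eq_zero_or_exists_partition b with h0 | ⟨k, P, lam, hP, hlam, hlam1, hcov, hx⟩
  · have : {S ∈ M.powerset | v S < 1 / 2 * APS M v b} = ∅ := by
      refine Finset.filter_eq_empty_iff.2 fun S hS => ?_
      rw [h0, mul_zero, not_lt]
      exact hv.nonneg (mem_powerset.1 hS)
    rw [this, card_empty, Nat.cast_zero]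
    positivity
  · refine (hv.card_filter_lt_le hb P lam hP hlam hlam1 hcov hx).trans_lt ?_
    rw [Real.rpow_sub (by norm_num), Real.rpow_natCast, div_lt_iff₀ (by positivity)]
    have hber := one_add_mul_self_le_rpow_one_add (s := 1) (by norm_num)
      (p := 1 / b) ((one_le_div hb).2 hb1)
    norm_num at hber
    have : 1 < b * (2 : ℝ) ^ (1 / b) := by
      have h := mul_le_mul_of_nonneg_left hber hb.le
      rw [mul_add, mul_inv_cancel₀ hb.ne'] at h
      rw [one_div]
      linarith
    have h2 : (0 : ℝ) < 2 ^ #M := by positivity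
    nlinarith

theorem Finset.exists_mem_and_eq_or_eq_of_card_le_two {β : Type*} [DecidableEq β] [Nonempty β]
    (s : Finset β) (hs : #s ≤ 2) :
    ∃ a c : β, (s.Nonempty → a ∈ s ∧ c ∈ s) ∧ ∀ i ∈ s, i = a ∨ i = c := by
  rcases s.eq_empty_or_nonempty with rfl | ⟨a, ha⟩
  · inhabit β
    exact ⟨default, default, by simp, by simp⟩
  · have hcard : #(s.erase a) ≤ 1 := by rw [card_erase_of_mem ha]; omega
    rcases (s.erase a).eq_empty_or_nonempty with h | ⟨c, hc⟩
    · refine ⟨a, a, fun _ => ⟨ha, ha⟩, fun i hi => Or.inl ?_⟩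
      by_contra hne
      have := mem_erase.2 ⟨hne, hi⟩
      simp [h] at this
    · refine ⟨a, c, fun _ => ⟨ha, mem_of_mem_erase hc⟩, fun i hi => ?_⟩
      by_cases hne : i = a
      · exact Or.inl hne
      · exact Or.inr (card_le_one.1 hcard i (mem_erase.2 ⟨hne, hi⟩) c hc)

theorem stmt15 {α : Type*} [DecidableEq α] (n : ℕ)
    (M : Finset α) (E : α → Finset (Fin n)) (hE : ∀ e ∈ M, (E e).card ≤ 2)
    (v : Fin n → Finset α → ℝ) (hv : ∀ i, IsValuation M (v i))
    (hloc : ∀ i, ∀ S ⊆ M, v i S = v i (S.filter fun e => i ∈ E e))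
    (b : Fin n → ℝ) (hb : ∀ i, 0 < b i) (hbsum : ∑ i, b i = 1) :
    ∃ f : α → Fin n,
      (∀ e ∈ M, (E e).Nonempty → f e ∈ E e) ∧
      ∀ i, v i (M.filter fun e => f e = i) ≥ (1 / 2) * APS M (v i) (b i) := by
  have hne : Nonempty (Fin n) := by
    by_contra h
    rw [not_nonempty_iff] at h
    simp at hbsum
  have hends : ∀ e, ∃ a c : Fin n, e ∈ M →
      ((E e).Nonempty → a ∈ E e ∧ c ∈ E e) ∧ ∀ i ∈ E e, i = a ∨ i = c := by
    intro e
    by_cases he : e ∈ M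
    · obtain ⟨a, c, h⟩ := (E e).exists_mem_and_eq_or_eq_of_card_le_two (hE e he)
      exact ⟨a, c, fun _ => h⟩
    · exact ⟨hne.some, hne.some, fun h => absurd h he⟩
  choose a c hac using hends
  have hb1 : ∀ i, b i ≤ 1 := fun i =>
    hbsum ▸ Finset.single_le_sum (fun j _ => (hb j).le) (mem_univ i)
  set f : Finset α → α → Fin n := fun S e => if e ∈ S then a e else c e with hf
  set bad : Fin n → Finset (Finset α) := fun i =>
    {S ∈ M.powerset | v i (M.filter fun e => f S e = i) < 1 / 2 * APS M (v i) (b i)} with hbad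
  have hcount : ∀ i, (#(bad i) : ℝ) < b i * 2 ^ #M := by
    intro i
    refine lt_of_le_of_lt ?_ ((hv i).card_filter_lt_aps_lt (hb i) (hb1 i))
    set D : Finset α := {e ∈ M | c e = i ∧ a e ≠ i} with hD
    have hDM : D ⊆ M := filter_subset _ _
    refine Nat.cast_le.2 (Finset.card_le_card_of_injOn (fun S => symmDiff S D) ?_ ?_)
    · intro S hS
      simp only [hbad, coe_filter, mem_powerset, Set.mem_ofPred_eq] at hS ⊢
      have hSD : symmDiff S D ⊆ M := by
        intro e he
        rcases mem_symmDiff.1 he with h | h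
        · exact hS.1 h.1
        · exact hDM h.1
      refine ⟨hSD, lt_of_le_of_lt ?_ hS.2⟩
      rw [hloc i _ hSD]
      refine (hv i).2.1 _ _ (fun e he => ?_) (filter_subset _ _)
      rw [mem_filter, mem_symmDiff] at he
      obtain ⟨he, hiE⟩ := he
      have heM : e ∈ M := he.elim (fun h => hS.1 h.1) (fun h => hDM h.1)
      have hi := (hac e heM).2 i hiE
      simp only [hD, mem_filter] at he
      simp only [mem_filter, hf]
      refine ⟨heM, ?_⟩
      split_ifs with heS
      · by_contra hne'
        exact (he.resolve_right fun h => h.2 heS).2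
          ⟨heM, (hi.resolve_left (Ne.symm hne')).symm, hne'⟩
      · exact (he.resolve_left fun h => heS h.1).1.2.1
    · intro S _ T _ h
      exact symmDiff_left_injective D h
  have hlt : #(Finset.univ.biUnion bad) < #M.powerset := by
    have h1 : (#(Finset.univ.biUnion bad) : ℝ) ≤ ∑ i, (#(bad i) : ℝ) := by
      exact_mod_cast Finset.card_biUnion_le
    have h2 : ∑ i, (#(bad i) : ℝ) < ∑ i, b i * 2 ^ #M :=
      Finset.sum_lt_sum_of_nonempty univ_nonempty fun i _ => hcount i
    rw [← Finset.sum_mul, hbsum, one_mul] at h2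
    rw [card_powerset]
    exact_mod_cast h1.trans_lt h2
  obtain ⟨S, hS, hgood⟩ := Finset.exists_mem_notMem_of_card_lt_card hlt
  refine ⟨f S, fun e he hEne => ?_, fun i => ?_⟩
  · have h := (hac e he).1 hEne
    simp only [hf]
    split_ifs
    · exact h.1
    · exact h.2
  · by_contra hlow
    exact hgood (mem_biUnion.2 ⟨i, mem_univ i, mem_filter.2 ⟨hS, not_le.1 hlow⟩⟩)
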